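/- Let U ⊆ ℂ × ℂ be open, x ∈ U, let f, g be nonvanishing holomorphic functions on U, and define ω1 = (f,0), ω2 = (0,g), ω3 = (−f,−g), Ω = f·g, h1 = −f_w/(fg), h2 = g_z/(fg), F = ∂_z(f_w/f), G = ∂_w(g_z/g), and assume F − G is nonvanishing on U. Define Ξ = (1/(F−G))·[ 2·(d(h1·ω2 + 2h2·ω1)/Ω)·dω2 + 2·(d(2h1·ω2 + h2·ω1)/Ω)·dω1 + d(d(h1·ω2 + 2h2·ω1)/Ω)∧ω2 + d(d(2h1·ω2 + h2·ω1)/Ω)∧ω1 ], and let η = (0, −f²g, −fg², 0) be the symmetric product of ω1, ω2, ω3. Then η is closed at x if and only if the equations d(Ξ·ω2) = d(2h1·ω2 + h2·ω1) and −d(Ξ·ω1) = d(h1·ω2 + 2h2·ω1) hold on some open neighborhood of x. -/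

import Mathlib

noncomputable section

/-- Partial derivative in the first (`z`) variable. -/
def pz (F : ℂ × ℂ → ℂ) (p : ℂ × ℂ) : ℂ := fderiv ℂ F p (1, 0)

/-- Partial derivative in the second (`w`) variable. -/
def pw (F : ℂ × ℂ → ℂ) (p : ℂ × ℂ) : ℂ := fderiv ℂ F p (0, 1)

/-- A 1-form `P dz + Q dw` given by its pair of coefficient functions. -/
abbrev Form1 := (ℂ × ℂ → ℂ) × (ℂ × ℂ → ℂ)

/-- A 1-form is holomorphic on `U` if both coefficients are. -/
def HoloForm (ω : Form1) (U : Set (ℂ × ℂ)) : Prop :=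
  DifferentiableOn ℂ ω.1 U ∧ DifferentiableOn ℂ ω.2 U

/-- Wedge product of two 1-forms (coefficient of `dz ∧ dw`). -/
def wedge (ω ω' : Form1) (p : ℂ × ℂ) : ℂ := ω.1 p * ω'.2 p - ω.2 p * ω'.1 p

/-- Exterior derivative `Q_z - P_w` of `P dz + Q dw` (coefficient of `dz ∧ dw`). -/
def dForm (ω : Form1) (p : ℂ × ℂ) : ℂ := pz ω.2 p - pw ω.1 p

/-- A 1-form `P dz + Q dw` is closed on `V` if `P_w = Q_z` there. -/
def IsClosed1 (ω : Form1) (V : Set (ℂ × ℂ)) : Prop := ∀ p ∈ V, pw ω.1 p = pz ω.2 p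

/-- The differential of a function, as a 1-form. -/
def dfun (φ : ℂ × ℂ → ℂ) : Form1 := (pz φ, pw φ)

def addF (ω ω' : Form1) : Form1 := (fun p => ω.1 p + ω'.1 p, fun p => ω.2 p + ω'.2 p)
def subF (ω ω' : Form1) : Form1 := (fun p => ω.1 p - ω'.1 p, fun p => ω.2 p - ω'.2 p)
def fsmul (h : ℂ × ℂ → ℂ) (ω : Form1) : Form1 :=
  (fun p => h p * ω.1 p, fun p => h p * ω.2 p)
def csmul (c : ℂ) (ω : Form1) : Form1 := (fun p => c * ω.1 p, fun p => c * ω.2 p)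

/-- Coefficients of the symmetric product of three 1-forms. -/
def symC0 (a b c : Form1) (p : ℂ × ℂ) : ℂ := a.1 p * b.1 p * c.1 p
def symC1 (a b c : Form1) (p : ℂ × ℂ) : ℂ :=
  a.1 p * b.1 p * c.2 p + a.1 p * b.2 p * c.1 p + a.2 p * b.1 p * c.1 p
def symC2 (a b c : Form1) (p : ℂ × ℂ) : ℂ :=
  a.1 p * b.2 p * c.2 p + a.2 p * b.1 p * c.2 p + a.2 p * b.2 p * c.1 p
def symC3 (a b c : Form1) (p : ℂ × ℂ) : ℂ := a.2 p * b.2 p * c.2 p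

/-- The symmetric 3-differential `c0 dz³ + c1 dz²dw + c2 dz dw² + c3 dw³` is
non-degenerate at `x` if the binary cubic `c0 s³ + c1 s²t + c2 st² + c3 t³` is nonzero
and has three pairwise non-proportional roots in the projective line. -/
def NonDegAt (c0 c1 c2 c3 : ℂ × ℂ → ℂ) (x : ℂ × ℂ) : Prop :=
  (c0 x ≠ 0 ∨ c1 x ≠ 0 ∨ c2 x ≠ 0 ∨ c3 x ≠ 0) ∧
  ∃ r : Fin 3 → ℂ × ℂ,
    (∀ i j, i ≠ j → (r i).1 * (r j).2 - (r i).2 * (r j).1 ≠ 0) ∧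
    (∀ i, c0 x * (r i).1 ^ 3 + c1 x * (r i).1 ^ 2 * (r i).2 +
          c2 x * (r i).1 * (r i).2 ^ 2 + c3 x * (r i).2 ^ 3 = 0)

/-- A symmetric 3-differential is closed at `x` if on some open neighborhood of `x`
(inside `U`) it is a symmetric product of three closed holomorphic 1-forms. -/
def ClosedAt (U : Set (ℂ × ℂ)) (c0 c1 c2 c3 : ℂ × ℂ → ℂ) (x : ℂ × ℂ) : Prop :=
  ∃ V : Set (ℂ × ℂ), IsOpen V ∧ x ∈ V ∧ V ⊆ U ∧
    ∃ z1 z2 z3 : Form1,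
      HoloForm z1 V ∧ HoloForm z2 V ∧ HoloForm z3 V ∧
      IsClosed1 z1 V ∧ IsClosed1 z2 V ∧ IsClosed1 z3 V ∧
      ∀ p ∈ V, c0 p = symC0 z1 z2 z3 p ∧ c1 p = symC1 z1 z2 z3 p ∧
               c2 p = symC2 z1 z2 z3 p ∧ c3 p = symC3 z1 z2 z3 p

/-- `D1 × D2` is an open polydisc. -/
def IsPolydisc (D1 D2 : Set ℂ) : Prop :=
  ∃ z0 w0 : ℂ, ∃ r1 r2 : ℝ, 0 < r1 ∧ 0 < r2 ∧
    D1 = Metric.ball z0 r1 ∧ D2 = Metric.ball w0 r2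

/-- `A = ∂_z(a_w/a)`. -/
def Afun (a : ℂ × ℂ → ℂ) : ℂ × ℂ → ℂ := pz (fun p => pw a p / a p)

/-- `B = ∂_w(b_z/b)`. -/
def Bfun (b : ℂ × ℂ → ℂ) : ℂ × ℂ → ℂ := pw (fun p => pz b p / b p)

/-- `ξ = (1/(A−B))·[ a·∂_z((b/a)·B) − b·∂_w((a/b)·A) ]`. -/
def xifun (a b : ℂ × ℂ → ℂ) : ℂ × ℂ → ℂ := fun p =>
  (Afun a p - Bfun b p)⁻¹ *
    (a p * pz (fun q => b q / a q * Bfun b q) p -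
     b p * pw (fun q => a q / b q * Afun a q) p)

/-! Web-theoretic data attached to nonvanishing holomorphic functions `f`, `g`:
`ω1 = f dz`, `ω2 = g dw`, `ω3 = -f dz - g dw`, `Ω = f·g`,
`h1 = -f_w/(fg)`, `h2 = g_z/(fg)`, `h3 = (f_w - g_z)/(fg)`,
`γ = h2·ω1 - h1·ω2`, `F = ∂_z(f_w/f)`, `G = ∂_w(g_z/g)`. -/

def om1 (f g : ℂ × ℂ → ℂ) : Form1 := (f, fun _ => 0)
def om2 (f g : ℂ × ℂ → ℂ) : Form1 := (fun _ => 0, g)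
def om3 (f g : ℂ × ℂ → ℂ) : Form1 := (fun p => -f p, fun p => -g p)
def Om (f g : ℂ × ℂ → ℂ) : ℂ × ℂ → ℂ := fun p => f p * g p
def h1f (f g : ℂ × ℂ → ℂ) : ℂ × ℂ → ℂ := fun p => -(pw f p) / (f p * g p)
def h2f (f g : ℂ × ℂ → ℂ) : ℂ × ℂ → ℂ := fun p => pz g p / (f p * g p)
def h3f (f g : ℂ × ℂ → ℂ) : ℂ × ℂ → ℂ := fun p => (pw f p - pz g p) / (f p * g p)
def gammaF (f g : ℂ × ℂ → ℂ) : Form1 :=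
  subF (fsmul (h2f f g) (om1 f g)) (fsmul (h1f f g) (om2 f g))
def Fcurv (f : ℂ × ℂ → ℂ) : ℂ × ℂ → ℂ := pz (fun p => pw f p / f p)
def Gcurv (g : ℂ × ℂ → ℂ) : ℂ × ℂ → ℂ := pw (fun p => pz g p / g p)

/-- The 1-form `h1·ω2 + 2h2·ω1`. -/
def T1 (f g : ℂ × ℂ → ℂ) : Form1 :=
  addF (fsmul (h1f f g) (om2 f g)) (csmul 2 (fsmul (h2f f g) (om1 f g)))

/-- The 1-form `2h1·ω2 + h2·ω1`. -/
def T2 (f g : ℂ × ℂ → ℂ) : Form1 :=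
  addF (csmul 2 (fsmul (h1f f g) (om2 f g))) (fsmul (h2f f g) (om1 f g))

/-- The function `Ξ` of the paper:
`Ξ = (1/dγ)[ 2(d(h1ω2+2h2ω1)/Ω)dω2 + 2(d(2h1ω2+h2ω1)/Ω)dω1
  + d(d(h1ω2+2h2ω1)/Ω)∧ω2 + d(d(2h1ω2+h2ω1)/Ω)∧ω1 ]`, with `dγ = F - G`. -/
def XiF (f g : ℂ × ℂ → ℂ) : ℂ × ℂ → ℂ := fun p =>
  (Fcurv f p - Gcurv g p)⁻¹ *
    (2 * (dForm (T1 f g) p / Om f g p) * dForm (om2 f g) p +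
     2 * (dForm (T2 f g) p / Om f g p) * dForm (om1 f g) p +
     wedge (dfun (fun q => dForm (T1 f g) q / Om f g q)) (om2 f g) p +
     wedge (dfun (fun q => dForm (T2 f g) q / Om f g q)) (om1 f g) p)

/-- Cauchy estimate for the Fréchet derivative of a bounded holomorphic function. -/
lemma norm_fderiv_le_of_forall_mem_ball_norm_le {E : Type*} [NormedAddCommGroup E]
    [NormedSpace ℂ E] {f : E → ℂ} {p : E} {ρ C : ℝ} (hρ : 0 < ρ)
    (hf : DifferentiableOn ℂ f (Metric.ball p (2 * ρ)))
    (hC : ∀ q ∈ Metric.ball p (2 * ρ), ‖f q‖ ≤ C) : ‖fderiv ℂ f p‖ ≤ C / ρ := by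
  have hp : p ∈ Metric.ball p (2 * ρ) := Metric.mem_ball_self (by positivity)
  have hC0 : 0 ≤ C := (norm_nonneg _).trans (hC p hp)
  refine ContinuousLinearMap.opNorm_le_bound _ (by positivity) fun v => ?_
  rcases eq_or_ne v 0 with rfl | hv
  · simp
  have hv' : 0 < ‖v‖ := norm_pos_iff.mpr hv
  have hmem : ∀ t : ℂ, t ∈ Metric.closedBall (0 : ℂ) (ρ / ‖v‖) →
      p + t • v ∈ Metric.ball p (2 * ρ) := by
    intro t ht
    rw [mem_closedBall_zero_iff, le_div_iff₀ hv'] at ht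
    rw [mem_ball_iff_norm, add_sub_cancel_left, norm_smul]
    linarith
  have hd : ∀ t ∈ Metric.closedBall (0 : ℂ) (ρ / ‖v‖),
      HasDerivAt (fun t : ℂ => f (p + t • v)) (fderiv ℂ f (p + t • v) v) t := by
    intro t ht
    have h1 := (hf.differentiableAt (Metric.isOpen_ball.mem_nhds (hmem t ht))).hasFDerivAt
    have h2 : HasDerivAt (fun t : ℂ => p + t • v) v t := by
      simpa using ((hasDerivAt_id t).smul_const v).const_add p
    exact h1.comp_hasDerivAt t h2
  have h0 := (hd 0 (Metric.mem_closedBall_self (by positivity))).deriv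
  have key := Complex.norm_deriv_le_of_forall_mem_sphere_norm_le (c := 0) (R := ρ / ‖v‖) (C := C)
    (f := fun t : ℂ => f (p + t • v)) (by positivity)
    (DifferentiableOn.diffContOnCl (fun t ht =>
      (hd t (Metric.closure_ball_subset_closedBall ht)).differentiableAt.differentiableWithinAt))
    (fun t ht => hC _ (hmem t (Metric.sphere_subset_closedBall ht)))
  rw [h0] at key
  simp only [zero_smul, add_zero] at key
  calc _ ≤ C / (ρ / ‖v‖) := key
    _ = C / ρ * ‖v‖ := by field_simp

/-- Directional derivatives of a holomorphic function are holomorphic. -/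
lemma differentiableOn_fderiv_apply {E : Type*} [NormedAddCommGroup E]
    [NormedSpace ℂ E] [FiniteDimensional ℂ E] {f : E → ℂ} {U : Set E} (hU : IsOpen U)
    (hf : DifferentiableOn ℂ f U) (v : E) :
    DifferentiableOn ℂ (fun p => fderiv ℂ f p v) U := by
  intro p₀ hp₀
  apply DifferentiableAt.differentiableWithinAt
  rcases eq_or_ne v 0 with rfl | hv
  · simp
  have hv' : 0 < ‖v‖ := norm_pos_iff.mpr hv
  obtain ⟨ρ, hρ, hb, C, hC⟩ : ∃ ρ : ℝ, 0 < ρ ∧ Metric.ball p₀ (4 * ρ) ⊆ U ∧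
      ∃ C : ℝ, ∀ q ∈ Metric.ball p₀ (4 * ρ), ‖f q‖ ≤ C := by
    have hc : ContinuousAt f p₀ := (hf.differentiableAt (hU.mem_nhds hp₀)).continuousAt
    have h1 : ∀ᶠ q in nhds p₀, ‖f q‖ < ‖f p₀‖ + 1 :=
      hc.norm.eventually_lt continuousAt_const (by linarith)
    obtain ⟨ε, hε, h⟩ := Metric.mem_nhds_iff.mp (Filter.inter_mem (hU.mem_nhds hp₀) h1)
    have he : 4 * (ε / 4) = ε := by ring
    refine ⟨ε / 4, by positivity, ?_, ‖f p₀‖ + 1, ?_⟩ <;> rw [he]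
    · exact fun q hq => (h hq).1
    · exact fun q hq => (h hq).2.le
  have hfb := hf.mono hb
  have hR : 0 < ρ / ‖v‖ := by positivity
  set R := ρ / ‖v‖ with hRdef
  have hmem : ∀ q ∈ Metric.ball p₀ ρ, ∀ t : ℂ, ‖t‖ ≤ R →
      q + t • v ∈ Metric.ball p₀ (2 * ρ) := by
    intro q hq t ht
    rw [hRdef, le_div_iff₀ hv'] at ht
    rw [mem_ball_iff_norm] at hq ⊢
    calc ‖q + t • v - p₀‖ = ‖(q - p₀) + t • v‖ := by congr 1; abel
      _ ≤ ‖q - p₀‖ + ‖t • v‖ := norm_add_le _ _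
      _ < 2 * ρ := by rw [norm_smul]; linarith
  have h24 : Metric.ball p₀ (2 * ρ) ⊆ Metric.ball p₀ (4 * ρ) :=
    Metric.ball_subset_ball (by linarith)
  have hbound : ∀ q ∈ Metric.ball p₀ (2 * ρ), ‖fderiv ℂ f q‖ ≤ C / ρ := by
    intro q hq
    have hsub : Metric.ball q (2 * ρ) ⊆ Metric.ball p₀ (4 * ρ) := by
      apply Metric.ball_subset_ball'
      rw [Metric.mem_ball] at hq
      linarith
    exact norm_fderiv_le_of_forall_mem_ball_norm_le hρ (hfb.mono hsub) fun r hr => hC r (hsub hr)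
  have hdat : ∀ q ∈ Metric.ball p₀ (2 * ρ), DifferentiableAt ℂ f q := fun q hq =>
    hfb.differentiableAt (Metric.isOpen_ball.mem_nhds (h24 hq))
  have hcm : ∀ θ : ℝ, ‖circleMap 0 R θ‖ ≤ R := by
    intro θ
    rw [norm_circleMap_zero, abs_of_pos hR]
  let k : ℝ → ℂ := fun θ =>
    deriv (circleMap 0 R) θ * (circleMap 0 R θ ^ 2)⁻¹
  have hk : Continuous k := by
    have h1 : ∀ θ, circleMap 0 R θ ^ 2 ≠ 0 := fun θ =>
      pow_ne_zero _ (circleMap_ne_center hR.ne')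
    simp only [k, deriv_circleMap]
    exact ((continuous_circleMap 0 R).mul continuous_const).mul
      (((continuous_circleMap 0 R).pow 2).inv₀ h1)
  have hcomp : ∀ q ∈ Metric.ball p₀ ρ, ∀ θ : ℝ,
      HasFDerivAt (fun q => k θ • f (q + circleMap 0 R θ • v))
        (k θ • fderiv ℂ f (q + circleMap 0 R θ • v)) q := by
    intro q hq θ
    have h1 := (hdat _ (hmem q hq _ (hcm θ))).hasFDerivAt
    have h2 : HasFDerivAt (fun q : E => q + circleMap 0 R θ • v) (ContinuousLinearMap.id ℂ E) q :=
      (hasFDerivAt_id q).add_const _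
    exact (h1.comp q h2).const_smul (k θ)
  have hcont : ∀ q ∈ Metric.ball p₀ ρ,
      Continuous (fun θ : ℝ => k θ • f (q + circleMap 0 R θ • v)) := by
    intro q hq
    refine hk.smul (continuous_iff_continuousAt.mpr fun θ => ?_)
    have h1 := (hdat _ (hmem q hq _ (hcm θ))).continuousAt
    have h2 : ContinuousAt (fun θ : ℝ => q + circleMap 0 R θ • v) θ :=
      (continuous_const.add ((continuous_circleMap 0 R).smul continuous_const)).continuousAt
    exact ContinuousAt.comp (f := fun θ : ℝ => q + circleMap 0 R θ • v) h1 h2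
  have hp₀' : p₀ ∈ Metric.ball p₀ ρ := Metric.mem_ball_self hρ
  have hmain : HasFDerivAt
      (fun q => ∫ θ in (0 : ℝ)..2 * Real.pi, k θ • f (q + circleMap 0 R θ • v))
      (∫ θ in (0 : ℝ)..2 * Real.pi, k θ • fderiv ℂ f (p₀ + circleMap 0 R θ • v)) p₀ := by
    refine intervalIntegral.hasFDerivAt_integral_of_dominated_of_fderiv_le
      (bound := fun θ => ‖k θ‖ * (C / ρ))
      (F' := fun q θ => k θ • fderiv ℂ f (q + circleMap 0 R θ • v))
      (Metric.ball_mem_nhds p₀ hρ) ?_ ?_ ?_ ?_ ?_ ?_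
    · filter_upwards [Metric.ball_mem_nhds p₀ hρ] with q hq
      exact (hcont q hq).aestronglyMeasurable
    · exact (hcont p₀ hp₀').intervalIntegrable _ _
    · borelize E
      have : ProperSpace (E →L[ℂ] ℂ) := FiniteDimensional.proper ℂ _
      borelize (E →L[ℂ] ℂ)
      have hm : Measurable (fun θ : ℝ => fderiv ℂ f (p₀ + circleMap 0 R θ • v)) :=
        (measurable_fderiv ℂ f).comp
          (continuous_const.add
            ((continuous_circleMap 0 R).smul continuous_const)).measurable
      exact hk.aestronglyMeasurable.smul hm.aestronglyMeasurable
    · refine Filter.Eventually.of_forall fun θ _ q hq => ?_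
      rw [norm_smul]
      exact mul_le_mul_of_nonneg_left (hbound _ (hmem q hq _ (hcm θ))) (norm_nonneg _)
    · exact (hk.norm.mul continuous_const).intervalIntegrable _ _
    · exact Filter.Eventually.of_forall fun θ _ q hq => hcomp q hq θ
  have heq : (fun p => fderiv ℂ f p v) =ᶠ[nhds p₀] fun q => (2 * Real.pi * Complex.I : ℂ)⁻¹ •
      ∫ θ in (0 : ℝ)..2 * Real.pi, k θ • f (q + circleMap 0 R θ • v) := by
    filter_upwards [Metric.ball_mem_nhds p₀ hρ] with q hq
    let W : Set ℂ := (fun t : ℂ => q + t • v) ⁻¹' Metric.ball p₀ (2 * ρ)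
    have hWc : Continuous (fun t : ℂ => q + t • v) := by fun_prop
    have hW : IsOpen W := Metric.isOpen_ball.preimage hWc
    have hsub : Metric.closedBall (0 : ℂ) R ⊆ W := fun t ht =>
      hmem q hq t (mem_closedBall_zero_iff.mp ht)
    have hd : ∀ t ∈ W, HasDerivAt (fun t : ℂ => f (q + t • v)) (fderiv ℂ f (q + t • v) v) t := by
      intro t ht
      have h2 : HasDerivAt (fun t : ℂ => q + t • v) v t := by
        simpa using ((hasDerivAt_id t).smul_const v).const_add q
      exact (hdat _ ht).hasFDerivAt.comp_hasDerivAt t h2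
    have key := Complex.two_pi_I_inv_smul_circleIntegral_sub_sq_inv_smul_of_differentiable hW hsub
      (fun t ht => (hd t ht).differentiableAt.differentiableWithinAt)
      (Metric.mem_ball_self hR)
    rw [(hd 0 (hsub (Metric.mem_closedBall_self hR.le))).deriv] at key
    simp only [zero_smul, add_zero, sub_zero] at key
    rw [← key]
    simp only [circleIntegral, k, smul_eq_mul, mul_assoc]
  exact (hmain.differentiableAt.const_smul (2 * Real.pi * Complex.I : ℂ)⁻¹).congr_of_eventuallyEq heq

lemma differentiableOn_pz {F : ℂ × ℂ → ℂ} {U : Set (ℂ × ℂ)} (hU : IsOpen U)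
    (hF : DifferentiableOn ℂ F U) : DifferentiableOn ℂ (pz F) U :=
  differentiableOn_fderiv_apply hU hF (1, 0)

lemma differentiableOn_pw {F : ℂ × ℂ → ℂ} {U : Set (ℂ × ℂ)} (hU : IsOpen U)
    (hF : DifferentiableOn ℂ F U) : DifferentiableOn ℂ (pw F) U :=
  differentiableOn_fderiv_apply hU hF (0, 1)

/-- Mixed partial derivatives of a holomorphic function commute. -/
lemma pz_pw_comm {F : ℂ × ℂ → ℂ} {U : Set (ℂ × ℂ)} (hU : IsOpen U)
    (hF : DifferentiableOn ℂ F U) {p : ℂ × ℂ} (hp : p ∈ U) :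
    pz (pw F) p = pw (pz F) p := by
  have hd : DifferentiableAt ℂ (fderiv ℂ F) p := by
    have hsplit : fderiv ℂ F = fun q => pz F q • ContinuousLinearMap.fst ℂ ℂ ℂ
        + pw F q • ContinuousLinearMap.snd ℂ ℂ ℂ := by
      funext q
      ext <;> simp [pz, pw]
    rw [hsplit]
    have h1 := (differentiableOn_pz hU hF).differentiableAt (hU.mem_nhds hp)
    have h2 := (differentiableOn_pw hU hF).differentiableAt (hU.mem_nhds hp)
    exact (h1.smul_const _).add (h2.smul_const _)
  have hsymm := second_derivative_symmetric_of_eventually (𝕜 := ℂ) (f := F) (x := p)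
    (Filter.eventually_of_mem (hU.mem_nhds hp) fun q hq =>
      (hF.differentiableAt (hU.mem_nhds hq)).hasFDerivAt) hd.hasFDerivAt (1, 0) (0, 1)
  have happ : ∀ v u : ℂ × ℂ, fderiv ℂ (fun q => fderiv ℂ F q v) p u =
      fderiv ℂ (fderiv ℂ F) p u v := by
    intro v u
    rw [fderiv_clm_apply hd (differentiableAt_const v)]
    simp
  change fderiv ℂ (fun q => fderiv ℂ F q (0, 1)) p (1, 0) =
    fderiv ℂ (fun q => fderiv ℂ F q (1, 0)) p (0, 1)
  rw [happ, happ, hsymm]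

/-- Quotients of holomorphic functions on `ℂ × ℂ` are holomorphic. -/
lemma DifferentiableOn.quot {F G : ℂ × ℂ → ℂ} {U : Set (ℂ × ℂ)} (hF : DifferentiableOn ℂ F U)
    (hG : DifferentiableOn ℂ G U) (h0 : ∀ p ∈ U, G p ≠ 0) :
    DifferentiableOn ℂ (fun q => F q / G q) U := by
  simpa only [div_eq_mul_inv] using hF.fun_mul (hG.fun_inv h0)

lemma pz_congr {F G : ℂ × ℂ → ℂ} {U : Set (ℂ × ℂ)} (hU : IsOpen U)
    (h : ∀ q ∈ U, F q = G q) {p : ℂ × ℂ} (hp : p ∈ U) : pz F p = pz G p := by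
  rw [pz, pz, Filter.EventuallyEq.fderiv_eq (Filter.eventually_of_mem (hU.mem_nhds hp) h)]

lemma pw_congr {F G : ℂ × ℂ → ℂ} {U : Set (ℂ × ℂ)} (hU : IsOpen U)
    (h : ∀ q ∈ U, F q = G q) {p : ℂ × ℂ} (hp : p ∈ U) : pw F p = pw G p := by
  rw [pw, pw, Filter.EventuallyEq.fderiv_eq (Filter.eventually_of_mem (hU.mem_nhds hp) h)]

section Rules

variable {F G : ℂ × ℂ → ℂ} {p : ℂ × ℂ}

@[simp] lemma pz_const (c : ℂ) : pz (fun _ => c) p = 0 := by simp [pz]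

@[simp] lemma pw_const (c : ℂ) : pw (fun _ => c) p = 0 := by simp [pw]

lemma pz_add (hF : DifferentiableAt ℂ F p) (hG : DifferentiableAt ℂ G p) :
    pz (fun q => F q + G q) p = pz F p + pz G p := by
  simp [pz, fderiv_fun_add hF hG]

lemma pw_add (hF : DifferentiableAt ℂ F p) (hG : DifferentiableAt ℂ G p) :
    pw (fun q => F q + G q) p = pw F p + pw G p := by
  simp [pw, fderiv_fun_add hF hG]

lemma pz_sub (hF : DifferentiableAt ℂ F p) (hG : DifferentiableAt ℂ G p) :
    pz (fun q => F q - G q) p = pz F p - pz G p := by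
  simp [pz, fderiv_fun_sub hF hG]

lemma pw_sub (hF : DifferentiableAt ℂ F p) (hG : DifferentiableAt ℂ G p) :
    pw (fun q => F q - G q) p = pw F p - pw G p := by
  simp [pw, fderiv_fun_sub hF hG]

lemma pz_neg : pz (fun q => -F q) p = -pz F p := by
  simp [pz, fderiv_fun_neg]

lemma pw_neg : pw (fun q => -F q) p = -pw F p := by
  simp [pw, fderiv_fun_neg]

lemma pz_mul (hF : DifferentiableAt ℂ F p) (hG : DifferentiableAt ℂ G p) :
    pz (fun q => F q * G q) p = pz F p * G p + F p * pz G p := by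
  simp [pz, fderiv_fun_mul hF hG]; ring

lemma pw_mul (hF : DifferentiableAt ℂ F p) (hG : DifferentiableAt ℂ G p) :
    pw (fun q => F q * G q) p = pw F p * G p + F p * pw G p := by
  simp [pw, fderiv_fun_mul hF hG]; ring

lemma fderiv_div_apply (hF : DifferentiableAt ℂ F p) (hG : DifferentiableAt ℂ G p)
    (h0 : G p ≠ 0) (v : ℂ × ℂ) :
    fderiv ℂ (fun q => F q / G q) p v =
      (fderiv ℂ F p v * G p - F p * fderiv ℂ G p v) / G p ^ 2 := by
  have h1 : HasFDerivAt (fun q => (G q)⁻¹) (-(G p ^ 2)⁻¹ • fderiv ℂ G p) p :=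
    (hasDerivAt_inv h0).comp_hasFDerivAt p hG.hasFDerivAt
  have h2 := (hF.hasFDerivAt.mul h1).fderiv
  have h3 : (fun q => F q / G q) = F * fun q => (G q)⁻¹ := by
    funext q
    simp [div_eq_mul_inv]
  rw [h3, h2]
  simp
  field_simp
  ring

lemma pz_div (hF : DifferentiableAt ℂ F p) (hG : DifferentiableAt ℂ G p) (h0 : G p ≠ 0) :
    pz (fun q => F q / G q) p = (pz F p * G p - F p * pz G p) / G p ^ 2 :=
  fderiv_div_apply hF hG h0 _

lemma pw_div (hF : DifferentiableAt ℂ F p) (hG : DifferentiableAt ℂ G p) (h0 : G p ≠ 0) :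
    pw (fun q => F q / G q) p = (pw F p * G p - F p * pw G p) / G p ^ 2 :=
  fderiv_div_apply hF hG h0 _

end Rules

/-- The logarithmic derivatives of a nonvanishing holomorphic function form a closed form. -/
lemma pw_pz_div_self {F : ℂ × ℂ → ℂ} {U : Set (ℂ × ℂ)} (hU : IsOpen U)
    (hF : DifferentiableOn ℂ F U) (hF0 : ∀ p ∈ U, F p ≠ 0) {p : ℂ × ℂ} (hp : p ∈ U) :
    pw (fun q => pz F q / F q) p = pz (fun q => pw F q / F q) p := by
  have hn := hU.mem_nhds hp
  rw [pw_div ((differentiableOn_pz hU hF).differentiableAt hn) (hF.differentiableAt hn) (hF0 p hp),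
    pz_div ((differentiableOn_pw hU hF).differentiableAt hn) (hF.differentiableAt hn) (hF0 p hp),
    pz_pw_comm hU hF hp]
  ring

section Web

variable {f g : ℂ × ℂ → ℂ} {U : Set (ℂ × ℂ)}

lemma dForm_T1 (hU : IsOpen U) (hg : DifferentiableOn ℂ g U)
    (hf0 : ∀ p ∈ U, f p ≠ 0) (hg0 : ∀ p ∈ U, g p ≠ 0) {p : ℂ × ℂ} (hp : p ∈ U) :
    dForm (T1 f g) p = -(Fcurv f p + 2 * Gcurv g p) := by
  have hn := hU.mem_nhds hp
  have h1 : pz (T1 f g).2 p = pz (fun q => -(pw f q / f q)) p := by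
    refine pz_congr hU (fun q hq => ?_) hp
    have := hf0 q hq
    have := hg0 q hq
    simp only [T1, addF, fsmul, csmul, om1, om2, h1f, h2f]
    field_simp
    ring
  have h2 : pw (T1 f g).1 p = pw (fun q => 2 * (pz g q / g q)) p := by
    refine pw_congr hU (fun q hq => ?_) hp
    have := hf0 q hq
    have := hg0 q hq
    simp only [T1, addF, fsmul, csmul, om1, om2, h1f, h2f]
    field_simp
    ring
  rw [dForm, h1, h2, pz_neg, pw_mul (differentiableAt_const _)
    (((differentiableOn_pz hU hg).quot hg hg0).differentiableAt hn), pw_const, Fcurv, Gcurv]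
  ring

lemma dForm_T2 (hU : IsOpen U) (hf : DifferentiableOn ℂ f U)
    (hf0 : ∀ p ∈ U, f p ≠ 0) (hg0 : ∀ p ∈ U, g p ≠ 0) {p : ℂ × ℂ} (hp : p ∈ U) :
    dForm (T2 f g) p = -(2 * Fcurv f p + Gcurv g p) := by
  have hn := hU.mem_nhds hp
  have h1 : pz (T2 f g).2 p = pz (fun q => -2 * (pw f q / f q)) p := by
    refine pz_congr hU (fun q hq => ?_) hp
    have := hf0 q hq
    have := hg0 q hq
    simp only [T2, addF, fsmul, csmul, om1, om2, h1f, h2f]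
    field_simp
    ring
  have h2 : pw (T2 f g).1 p = pw (fun q => pz g q / g q) p := by
    refine pw_congr hU (fun q hq => ?_) hp
    have := hf0 q hq
    have := hg0 q hq
    simp only [T2, addF, fsmul, csmul, om1, om2, h1f, h2f]
    field_simp
    ring
  rw [dForm, h1, h2, pz_mul (differentiableAt_const _)
    (((differentiableOn_pw hU hf).quot hf hf0).differentiableAt hn), pz_const, Fcurv, Gcurv]
  ring

lemma dForm_fsmul_om2 (ξ : ℂ × ℂ → ℂ) (p : ℂ × ℂ) :
    dForm (fsmul ξ (om2 f g)) p = pz (fun q => ξ q * g q) p := by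
  simp [dForm, fsmul, om2]

lemma dForm_fsmul_om1 (ξ : ℂ × ℂ → ℂ) (p : ℂ × ℂ) :
    dForm (fsmul ξ (om1 f g)) p = -pw (fun q => ξ q * f q) p := by
  simp [dForm, fsmul, om1]

lemma XiF_eq (p : ℂ × ℂ) : XiF f g p = (Fcurv f p - Gcurv g p)⁻¹ *
    (2 * (dForm (T1 f g) p / (f p * g p)) * pz g p -
      2 * (dForm (T2 f g) p / (f p * g p)) * pw f p +
      pz (fun q => dForm (T1 f g) q / (f q * g q)) p * g p -
      pw (fun q => dForm (T2 f g) q / (f q * g q)) p * f p) := by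
  simp only [XiF, wedge, dfun, om1, om2, dForm, Om, pz_const, pw_const]
  ring

/-- The function `Ξ` is the only possible solution of the overdetermined system. -/
lemma eq_XiF (hU : IsOpen U) (hf : DifferentiableOn ℂ f U) (hg : DifferentiableOn ℂ g U)
    (hf0 : ∀ p ∈ U, f p ≠ 0) (hg0 : ∀ p ∈ U, g p ≠ 0)
    (hFG : ∀ p ∈ U, Fcurv f p - Gcurv g p ≠ 0) {ξ : ℂ × ℂ → ℂ} (hξ : DifferentiableOn ℂ ξ U)
    (h1 : ∀ p ∈ U, pw (fun q => ξ q * f q) p = dForm (T1 f g) p)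
    (h2 : ∀ p ∈ U, pz (fun q => ξ q * g q) p = dForm (T2 f g) p) {p : ℂ × ℂ} (hp : p ∈ U) :
    ξ p = XiF f g p := by
  have hn := hU.mem_nhds hp
  have hfz := differentiableOn_pz hU hf
  have hfw := differentiableOn_pw hU hf
  have hgz := differentiableOn_pz hU hg
  have hgw := differentiableOn_pw hU hg
  have hξz := differentiableOn_pz hU hξ
  have hξw := differentiableOn_pw hU hξ
  have hF := hfw.quot hf hf0
  have hG := hgz.quot hg hg0
  have e1 : ∀ q ∈ U, dForm (T1 f g) q / (f q * g q) =
      pw ξ q / g q + pw f q / f q * (ξ q / g q) := by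
    intro q hq
    have hq' := hU.mem_nhds hq
    have := hf0 q hq
    have := hg0 q hq
    rw [← h1 q hq, pw_mul (hξ.differentiableAt hq') (hf.differentiableAt hq')]
    field_simp
  have e2 : ∀ q ∈ U, dForm (T2 f g) q / (f q * g q) =
      pz ξ q / f q + pz g q / g q * (ξ q / f q) := by
    intro q hq
    have hq' := hU.mem_nhds hq
    have := hf0 q hq
    have := hg0 q hq
    rw [← h2 q hq, pz_mul (hξ.differentiableAt hq') (hg.differentiableAt hq')]
    field_simp
  have a1 : pz (fun q => dForm (T1 f g) q / (f q * g q)) p =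
      (pz (pw ξ) p * g p - pw ξ p * pz g p) / g p ^ 2 +
      (Fcurv f p * (ξ p / g p) +
        pw f p / f p * ((pz ξ p * g p - ξ p * pz g p) / g p ^ 2)) := by
    rw [pz_congr hU e1 hp, pz_add ((hξw.quot hg hg0).differentiableAt hn)
      ((hF.fun_mul (hξ.quot hg hg0)).differentiableAt hn),
      pz_mul (hF.differentiableAt hn) ((hξ.quot hg hg0).differentiableAt hn),
      pz_div (hξw.differentiableAt hn) (hg.differentiableAt hn) (hg0 p hp),
      pz_div (hξ.differentiableAt hn) (hg.differentiableAt hn) (hg0 p hp), Fcurv]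
  have a2 : pw (fun q => dForm (T2 f g) q / (f q * g q)) p =
      (pw (pz ξ) p * f p - pz ξ p * pw f p) / f p ^ 2 +
      (Gcurv g p * (ξ p / f p) +
        pz g p / g p * ((pw ξ p * f p - ξ p * pw f p) / f p ^ 2)) := by
    rw [pw_congr hU e2 hp, pw_add ((hξz.quot hf hf0).differentiableAt hn)
      ((hG.fun_mul (hξ.quot hf hf0)).differentiableAt hn),
      pw_mul (hG.differentiableAt hn) ((hξ.quot hf hf0).differentiableAt hn),
      pw_div (hξz.differentiableAt hn) (hf.differentiableAt hn) (hf0 p hp),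
      pw_div (hξ.differentiableAt hn) (hf.differentiableAt hn) (hf0 p hp), Gcurv]
  rw [XiF_eq, a1, a2, e1 p hp, e2 p hp, pz_pw_comm hU hξ hp, eq_inv_mul_iff_mul_eq₀ (hFG p hp)]
  have := hf0 p hp
  have := hg0 p hp
  field_simp
  ring

lemma differentiableOn_XiF (hU : IsOpen U) (hf : DifferentiableOn ℂ f U)
    (hg : DifferentiableOn ℂ g U) (hf0 : ∀ p ∈ U, f p ≠ 0) (hg0 : ∀ p ∈ U, g p ≠ 0)
    (hFG : ∀ p ∈ U, Fcurv f p - Gcurv g p ≠ 0) : DifferentiableOn ℂ (XiF f g) U := by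
  have hF : DifferentiableOn ℂ (Fcurv f) U :=
    differentiableOn_pz hU ((differentiableOn_pw hU hf).quot hf hf0)
  have hG : DifferentiableOn ℂ (Gcurv g) U :=
    differentiableOn_pw hU ((differentiableOn_pz hU hg).quot hg hg0)
  have hT1 : DifferentiableOn ℂ (dForm (T1 f g)) U :=
    ((hF.add (hG.const_mul 2)).neg).congr fun p hp => dForm_T1 hU hg hf0 hg0 hp
  have hT2 : DifferentiableOn ℂ (dForm (T2 f g)) U :=
    (((hF.const_mul 2).add hG).neg).congr fun p hp => dForm_T2 hU hf hf0 hg0 hp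
  have hΩ : ∀ p ∈ U, f p * g p ≠ 0 := fun p hp => mul_ne_zero (hf0 p hp) (hg0 p hp)
  have q1 := hT1.quot (hf.fun_mul hg) hΩ
  have q2 := hT2.quot (hf.fun_mul hg) hΩ
  have := ((hF.sub hG).inv hFG).mul
    (((((q1.const_mul 2).mul (differentiableOn_pz hU hg)).sub
      ((q2.const_mul 2).mul (differentiableOn_pw hU hf))).add
      ((differentiableOn_pz hU q1).mul hg)).sub ((differentiableOn_pw hU q2).mul hf))
  exact this.congr fun p _ => XiF_eq p

/-- If `P` depends only on `z` and `Q` only on `w`, the form `(f²g dz + fg² dw)/(PQ)` is closed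
exactly when the logarithmic derivatives of `f`, `g`, `P`, `Q` satisfy a linear relation. -/
lemma pw_eq_pz_quot_iff (hf : DifferentiableOn ℂ f U) (hg : DifferentiableOn ℂ g U)
    (hf0 : ∀ p ∈ U, f p ≠ 0) (hg0 : ∀ p ∈ U, g p ≠ 0) {P Q : ℂ × ℂ → ℂ}
    (hP : DifferentiableOn ℂ P U) (hQ : DifferentiableOn ℂ Q U)
    (hP0 : ∀ p ∈ U, P p ≠ 0) (hQ0 : ∀ p ∈ U, Q p ≠ 0)
    (hU : IsOpen U) {p : ℂ × ℂ} (hp : p ∈ U) (hPw : pw P p = 0) (hQz : pz Q p = 0) :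
    pw (fun q => f q * f q * g q / (P q * Q q)) p =
        pz (fun q => f q * g q * g q / (P q * Q q)) p ↔
      g p * (pz P p / P p - pz f p / f p - 2 * (pz g p / g p)) =
        f p * (pw Q p / Q p - pw g p / g p - 2 * (pw f p / f p)) := by
  have hn := hU.mem_nhds hp
  have df := hf.differentiableAt hn
  have dg := hg.differentiableAt hn
  have dP := hP.differentiableAt hn
  have dQ := hQ.differentiableAt hn
  have f0 := hf0 p hp
  have g0 := hg0 p hp
  have P0 := hP0 p hp
  have Q0 := hQ0 p hp
  rw [pw_div ((df.fun_mul df).fun_mul dg) (dP.fun_mul dQ) (mul_ne_zero P0 Q0),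
    pz_div ((df.fun_mul dg).fun_mul dg) (dP.fun_mul dQ) (mul_ne_zero P0 Q0),
    pw_mul (df.fun_mul df) dg, pw_mul df df, pw_mul dP dQ,
    pz_mul (df.fun_mul dg) dg, pz_mul df dg, pz_mul dP dQ, hPw, hQz]
  field_simp
  constructor <;> intro h <;> linear_combination h

/-- A factorization of the normalized third factor forces the differential system for `Ξ`. -/
lemma dForm_XiF_of_factors (hU : IsOpen U) (hf : DifferentiableOn ℂ f U)
    (hg : DifferentiableOn ℂ g U) (hf0 : ∀ p ∈ U, f p ≠ 0) (hg0 : ∀ p ∈ U, g p ≠ 0)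
    (hFG : ∀ p ∈ U, Fcurv f p - Gcurv g p ≠ 0) {P Q : ℂ × ℂ → ℂ}
    (hP : DifferentiableOn ℂ P U) (hQ : DifferentiableOn ℂ Q U)
    (hP0 : ∀ p ∈ U, P p ≠ 0) (hQ0 : ∀ p ∈ U, Q p ≠ 0)
    (hPw : ∀ p ∈ U, pw P p = 0) (hQz : ∀ p ∈ U, pz Q p = 0)
    (h3 : ∀ p ∈ U, pw (fun q => f q * f q * g q / (P q * Q q)) p =
        pz (fun q => f q * g q * g q / (P q * Q q)) p) {p : ℂ × ℂ} (hp : p ∈ U) :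
    dForm (fsmul (XiF f g) (om2 f g)) p = dForm (T2 f g) p ∧
      -dForm (fsmul (XiF f g) (om1 f g)) p = dForm (T1 f g) p := by
  have lP := (differentiableOn_pz hU hP).quot hP hP0
  have lQ := (differentiableOn_pw hU hQ).quot hQ hQ0
  have lfz := (differentiableOn_pz hU hf).quot hf hf0
  have lfw := (differentiableOn_pw hU hf).quot hf hf0
  have lgz := (differentiableOn_pz hU hg).quot hg hg0
  have lgw := (differentiableOn_pw hU hg).quot hg hg0
  let ξ : ℂ × ℂ → ℂ := fun q =>
    (pz P q / P q - pz f q / f q - 2 * (pz g q / g q)) / f q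
  have hξ : DifferentiableOn ℂ ξ U := ((lP.fun_sub lfz).fun_sub (lgz.const_mul 2)).quot hf hf0
  have hξf : ∀ q ∈ U, ξ q * f q = pz P q / P q - pz f q / f q - 2 * (pz g q / g q) :=
    fun q hq => div_mul_cancel₀ _ (hf0 q hq)
  have hξg : ∀ q ∈ U, ξ q * g q = pw Q q / Q q - pw g q / g q - 2 * (pw f q / f q) := by
    intro q hq
    have h := (pw_eq_pz_quot_iff hf hg hf0 hg0 hP hQ hP0 hQ0 hU hq (hPw q hq) (hQz q hq)).mp
      (h3 q hq)
    rw [← hξf q hq] at h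
    exact mul_left_cancel₀ (hf0 q hq) (by linear_combination h)
  have h1 : ∀ q ∈ U, pw (fun q => ξ q * f q) q = dForm (T1 f g) q := by
    intro q hq
    have hn := hU.mem_nhds hq
    have hz : pw (fun q => pz P q / P q) q = 0 := by
      rw [pw_pz_div_self hU hP hP0 hq,
        pz_congr hU (G := fun _ => 0) (fun r hr => by rw [hPw r hr, zero_div]) hq, pz_const]
    rw [pw_congr hU hξf hq, pw_sub ((lP.fun_sub lfz).differentiableAt hn)
      ((lgz.const_mul 2).differentiableAt hn),
      pw_sub (lP.differentiableAt hn) (lfz.differentiableAt hn),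
      pw_mul (differentiableAt_const _) (lgz.differentiableAt hn), hz,
      pw_pz_div_self hU hf hf0 hq, dForm_T1 hU hg hf0 hg0 hq, Fcurv, Gcurv, pw_const]
    ring
  have h2 : ∀ q ∈ U, pz (fun q => ξ q * g q) q = dForm (T2 f g) q := by
    intro q hq
    have hn := hU.mem_nhds hq
    have hz : pz (fun q => pw Q q / Q q) q = 0 := by
      rw [← pw_pz_div_self hU hQ hQ0 hq,
        pw_congr hU (G := fun _ => 0) (fun r hr => by rw [hQz r hr, zero_div]) hq, pw_const]
    rw [pz_congr hU hξg hq, pz_sub ((lQ.fun_sub lgw).differentiableAt hn)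
      ((lfw.const_mul 2).differentiableAt hn),
      pz_sub (lQ.differentiableAt hn) (lgw.differentiableAt hn),
      pz_mul (differentiableAt_const _) (lfw.differentiableAt hn), hz,
      ← pw_pz_div_self hU hg hg0 hq, dForm_T2 hU hf hf0 hg0 hq, Fcurv, Gcurv, pz_const]
    ring
  have hΞ : ∀ q ∈ U, XiF f g q = ξ q := fun q hq =>
    (eq_XiF hU hf hg hf0 hg0 hFG hξ h1 h2 hq).symm
  rw [dForm_fsmul_om2, dForm_fsmul_om1, neg_neg, ← h1 p hp, ← h2 p hp]
  exact ⟨pz_congr hU (fun q hq => by rw [hΞ q hq]) hp,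
    pw_congr hU (fun q hq => by rw [hΞ q hq]) hp⟩

/-- The differential system holds near `x` when three closed factors of the cubic are labelled
so that the first is a multiple of `dz` and the second a multiple of `dw` near `x`. -/
lemma exists_dForm_XiF_of_closed_factors (hf : DifferentiableOn ℂ f U)
    (hg : DifferentiableOn ℂ g U) (hf0 : ∀ p ∈ U, f p ≠ 0) (hg0 : ∀ p ∈ U, g p ≠ 0)
    (hFG : ∀ p ∈ U, Fcurv f p - Gcurv g p ≠ 0) {V : Set (ℂ × ℂ)} (hV : IsOpen V) (hVU : V ⊆ U)
    {x : ℂ × ℂ} (hx : x ∈ V) {z1 z2 z3 : Form1}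
    (hz1 : HoloForm z1 V) (hz2 : HoloForm z2 V)
    (hc1 : IsClosed1 z1 V) (hc2 : IsClosed1 z2 V) (hc3 : IsClosed1 z3 V)
    (h1 : ∀ p ∈ V, -(f p ^ 2 * g p) = symC1 z1 z2 z3 p)
    (h2 : ∀ p ∈ V, -(f p * g p ^ 2) = symC2 z1 z2 z3 p)
    (hQ1 : ∀ᶠ p in nhds x, z1.2 p = 0) (hP2 : ∀ᶠ p in nhds x, z2.1 p = 0) :
    ∃ V : Set (ℂ × ℂ), IsOpen V ∧ x ∈ V ∧ V ⊆ U ∧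
        ∀ p ∈ V,
          dForm (fsmul (XiF f g) (om2 f g)) p = dForm (T2 f g) p ∧
          -dForm (fsmul (XiF f g) (om1 f g)) p = dForm (T1 f g) p := by
  obtain ⟨W, hWs, hW, hxW⟩ := mem_nhds_iff.mp (Filter.inter_mem (hV.mem_nhds hx) (hQ1.and hP2))
  have hWV : W ⊆ V := fun p hp => (hWs hp).1
  have hWU := hWV.trans hVU
  have e1 : ∀ p ∈ W, z1.1 p * z2.2 p * z3.1 p = -(f p * f p * g p) := by
    intro p hp
    have h := h1 p (hWV hp)
    rw [symC1, (hWs hp).2.1, (hWs hp).2.2] at h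
    linear_combination -h
  have e2 : ∀ p ∈ W, z1.1 p * z2.2 p * z3.2 p = -(f p * g p * g p) := by
    intro p hp
    have h := h2 p (hWV hp)
    rw [symC2, (hWs hp).2.1, (hWs hp).2.2] at h
    linear_combination -h
  have hne : ∀ p ∈ W, z1.1 p ≠ 0 ∧ z2.2 p ≠ 0 := by
    intro p hp
    have h : z1.1 p * z2.2 p * z3.1 p ≠ 0 := by
      rw [e1 p hp]
      exact neg_ne_zero.mpr (mul_ne_zero (mul_ne_zero (hf0 p (hWU hp)) (hf0 p (hWU hp)))
        (hg0 p (hWU hp)))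
    exact ⟨left_ne_zero_of_mul (left_ne_zero_of_mul h),
      right_ne_zero_of_mul (left_ne_zero_of_mul h)⟩
  refine ⟨W, hW, hxW, hWU, fun p hp => dForm_XiF_of_factors hW (hf.mono hWU) (hg.mono hWU)
    (fun p hp => hf0 p (hWU hp)) (fun p hp => hg0 p (hWU hp)) (fun p hp => hFG p (hWU hp))
    (hz1.1.mono hWV) (hz2.2.mono hWV) (fun p hp => (hne p hp).1) (fun p hp => (hne p hp).2)
    (fun p hp => ?_) (fun p hp => ?_) (fun p hp => ?_) hp⟩
  · rw [hc1 p (hWV hp), pz_congr hW (G := fun _ => 0) (fun q hq => (hWs hq).2.1) hp, pz_const]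
  · rw [← hc2 p (hWV hp), pw_congr hW (G := fun _ => 0) (fun q hq => (hWs hq).2.2) hp, pw_const]
  · have k1 : ∀ q ∈ W, f q * f q * g q / (z1.1 q * z2.2 q) = -z3.1 q := by
      intro q hq
      rw [div_eq_iff (mul_ne_zero (hne q hq).1 (hne q hq).2)]
      linear_combination e1 q hq
    have k2 : ∀ q ∈ W, f q * g q * g q / (z1.1 q * z2.2 q) = -z3.2 q := by
      intro q hq
      rw [div_eq_iff (mul_ne_zero (hne q hq).1 (hne q hq).2)]
      linear_combination e2 q hq
    rw [pw_congr hW k1 hp, pz_congr hW k2 hp, pw_neg, pz_neg, hc3 p (hWV hp)]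

end Web

/-- If a product of three continuous functions vanishes near `x` while the sum of their weighted
pairwise products does not vanish at `x`, one of the three vanishes near `x`. -/
lemma eventually_eq_zero_of_mul_mul_eq_zero {X : Type*} [TopologicalSpace X] {a b c : X → ℂ}
    {x : X} (ha : ContinuousAt a x) (hb : ContinuousAt b x) (hc : ContinuousAt c x)
    (h0 : ∀ᶠ p in nhds x, a p * b p * c p = 0) {r s t : ℂ}
    (h1 : a x * b x * t + a x * s * c x + r * b x * c x ≠ 0) :
    (∀ᶠ p in nhds x, a p = 0) ∨ (∀ᶠ p in nhds x, b p = 0) ∨ ∀ᶠ p in nhds x, c p = 0 := by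
  have key : (a x ≠ 0 ∧ b x ≠ 0) ∨ (a x ≠ 0 ∧ c x ≠ 0) ∨ (b x ≠ 0 ∧ c x ≠ 0) := by
    by_contra! h
    apply h1
    by_cases hA : a x = 0
    · by_cases hB : b x = 0
      · simp [hA, hB]
      · simp [hA, h.2.2 hB]
    · simp [h.1 hA, h.2.1 hA]
  rcases key with ⟨u, v⟩ | ⟨u, v⟩ | ⟨u, v⟩
  · right; right
    filter_upwards [h0, ha.eventually_ne u, hb.eventually_ne v] with p hp h1 h2
    simpa [h1, h2] using hp
  · right; left
    filter_upwards [h0, ha.eventually_ne u, hc.eventually_ne v] with p hp h1 h2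
    simpa [h1, h2] using hp
  · left
    filter_upwards [h0, hb.eventually_ne u, hc.eventually_ne v] with p hp h1 h2
    simpa [h1, h2] using hp

/-- A function holomorphic on a bidisc with vanishing `w`-derivative does not depend on `w`. -/
lemma eq_of_pw_eq_zero {F : ℂ × ℂ → ℂ} {x : ℂ × ℂ} {r : ℝ}
    (hF : DifferentiableOn ℂ F (Metric.ball x r)) (h : ∀ p ∈ Metric.ball x r, pw F p = 0)
    {p : ℂ × ℂ} (hp : p ∈ Metric.ball x r) : F p = F (p.1, x.2) := by
  have hp' := hp
  rw [← ball_prod_same, Set.mem_prod] at hp'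
  have hd : ∀ t ∈ Metric.ball x.2 r, HasDerivAt (fun t => F (p.1, t)) 0 t := by
    intro t ht
    have hm : (p.1, t) ∈ Metric.ball x r := by
      rw [← ball_prod_same]
      exact ⟨hp'.1, ht⟩
    have h1 := (hF.differentiableAt (Metric.isOpen_ball.mem_nhds hm)).hasFDerivAt
    have h2 : HasDerivAt (fun t : ℂ => (p.1, t)) ((0 : ℂ), (1 : ℂ)) t :=
      (hasDerivAt_const t p.1).prodMk (hasDerivAt_id t)
    have h3 := h1.comp_hasDerivAt t h2
    rwa [show fderiv ℂ F (p.1, t) (0, 1) = 0 from h _ hm] at h3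
  have hr : 0 < r := Metric.pos_of_mem_ball hp
  exact Metric.isOpen_ball.is_const_of_deriv_eq_zero (convex_ball x.2 r).isPreconnected
    (fun t ht => (hd t ht).differentiableAt.differentiableWithinAt) (fun t ht => (hd t ht).deriv)
    hp'.2 (Metric.mem_ball_self hr)

/-- A function holomorphic on a bidisc with vanishing `z`-derivative does not depend on `z`. -/
lemma eq_of_pz_eq_zero {F : ℂ × ℂ → ℂ} {x : ℂ × ℂ} {r : ℝ}
    (hF : DifferentiableOn ℂ F (Metric.ball x r)) (h : ∀ p ∈ Metric.ball x r, pz F p = 0)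
    {p : ℂ × ℂ} (hp : p ∈ Metric.ball x r) : F p = F (x.1, p.2) := by
  have hp' := hp
  rw [← ball_prod_same, Set.mem_prod] at hp'
  have hd : ∀ t ∈ Metric.ball x.1 r, HasDerivAt (fun t => F (t, p.2)) 0 t := by
    intro t ht
    have hm : (t, p.2) ∈ Metric.ball x r := by
      rw [← ball_prod_same]
      exact ⟨ht, hp'.2⟩
    have h1 := (hF.differentiableAt (Metric.isOpen_ball.mem_nhds hm)).hasFDerivAt
    have h2 : HasDerivAt (fun t : ℂ => (t, p.2)) ((1 : ℂ), (0 : ℂ)) t :=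
      (hasDerivAt_id t).prodMk (hasDerivAt_const t p.2)
    have h3 := h1.comp_hasDerivAt t h2
    rwa [show fderiv ℂ F (t, p.2) (1, 0) = 0 from h _ hm] at h3
  have hr : 0 < r := Metric.pos_of_mem_ball hp
  exact Metric.isOpen_ball.is_const_of_deriv_eq_zero (convex_ball x.1 r).isPreconnected
    (fun t ht => (hd t ht).differentiableAt.differentiableWithinAt) (fun t ht => (hd t ht).deriv)
    hp'.1 (Metric.mem_ball_self hr)

/-- On a bidisc, a holomorphic function of `z` alone is the logarithmic derivative of a
nonvanishing function of `z`. -/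
lemma exists_pz_div_eq {F : ℂ × ℂ → ℂ} {x : ℂ × ℂ} {r : ℝ}
    (hF : DifferentiableOn ℂ F (Metric.ball x r)) (h : ∀ p ∈ Metric.ball x r, pw F p = 0) :
    ∃ P : ℂ × ℂ → ℂ, DifferentiableOn ℂ P (Metric.ball x r) ∧ (∀ p, P p ≠ 0) ∧
      ∀ p ∈ Metric.ball x r, pw P p = 0 ∧ pz P p / P p = F p := by
  rcases le_or_gt r 0 with hr | hr
  · simp only [Metric.ball_eq_empty.mpr hr]
    exact ⟨fun _ => 1, differentiableOn_empty, by simp, by simp⟩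
  have hsl : DifferentiableOn ℂ (fun t => F (t, x.2)) (Metric.ball x.1 r) :=
    hF.fun_comp (by fun_prop) fun t ht => by
      rw [← ball_prod_same]
      exact ⟨ht, Metric.mem_ball_self hr⟩
  obtain ⟨k, hk⟩ := hsl.isExactOn_ball
  have hd : ∀ p ∈ Metric.ball x r, HasFDerivAt (fun q : ℂ × ℂ => Complex.exp (k q.1))
      (Complex.exp (k p.1) • F p • ContinuousLinearMap.fst ℂ ℂ ℂ) p := by
    intro p hp
    have hp' := hp
    rw [← ball_prod_same, Set.mem_prod] at hp'
    have h1 : HasDerivAt k (F (p.1, x.2)) p.1 := hk p.1 hp'.1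
    rw [← eq_of_pw_eq_zero hF h hp] at h1
    exact (h1.comp_hasFDerivAt p hasFDerivAt_fst).cexp
  refine ⟨fun q => Complex.exp (k q.1),
    fun p hp => (hd p hp).differentiableAt.differentiableWithinAt,
    fun p => Complex.exp_ne_zero _, fun p hp => ⟨?_, ?_⟩⟩
  · simp [pw, (hd p hp).fderiv]
  · simp [pz, (hd p hp).fderiv]

/-- On a bidisc, a holomorphic function of `w` alone is the logarithmic derivative of a
nonvanishing function of `w`. -/
lemma exists_pw_div_eq {F : ℂ × ℂ → ℂ} {x : ℂ × ℂ} {r : ℝ}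
    (hF : DifferentiableOn ℂ F (Metric.ball x r)) (h : ∀ p ∈ Metric.ball x r, pz F p = 0) :
    ∃ Q : ℂ × ℂ → ℂ, DifferentiableOn ℂ Q (Metric.ball x r) ∧ (∀ p, Q p ≠ 0) ∧
      ∀ p ∈ Metric.ball x r, pz Q p = 0 ∧ pw Q p / Q p = F p := by
  rcases le_or_gt r 0 with hr | hr
  · simp only [Metric.ball_eq_empty.mpr hr]
    exact ⟨fun _ => 1, differentiableOn_empty, by simp, by simp⟩
  have hsl : DifferentiableOn ℂ (fun t => F (x.1, t)) (Metric.ball x.2 r) :=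
    hF.fun_comp (by fun_prop) fun t ht => by
      rw [← ball_prod_same]
      exact ⟨Metric.mem_ball_self hr, ht⟩
  obtain ⟨k, hk⟩ := hsl.isExactOn_ball
  have hd : ∀ p ∈ Metric.ball x r, HasFDerivAt (fun q : ℂ × ℂ => Complex.exp (k q.2))
      (Complex.exp (k p.2) • F p • ContinuousLinearMap.snd ℂ ℂ ℂ) p := by
    intro p hp
    have hp' := hp
    rw [← ball_prod_same, Set.mem_prod] at hp'
    have h1 : HasDerivAt k (F (x.1, p.2)) p.2 := hk p.2 hp'.2
    rw [← eq_of_pz_eq_zero hF h hp] at h1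
    exact (h1.comp_hasFDerivAt p hasFDerivAt_snd).cexp
  refine ⟨fun q => Complex.exp (k q.2),
    fun p hp => (hd p hp).differentiableAt.differentiableWithinAt,
    fun p => Complex.exp_ne_zero _, fun p hp => ⟨?_, ?_⟩⟩
  · simp [pz, (hd p hp).fderiv]
  · simp [pw, (hd p hp).fderiv]

/-- A solution of the differential system near `x` yields a closed decomposition of the cubic. -/
lemma closedAt_of_dForm_XiF {f g : ℂ × ℂ → ℂ} {U V : Set (ℂ × ℂ)} (hV : IsOpen V) (hVU : V ⊆ U)
    {x : ℂ × ℂ} (hx : x ∈ V) (hf : DifferentiableOn ℂ f V) (hg : DifferentiableOn ℂ g V)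
    (hf0 : ∀ p ∈ V, f p ≠ 0) (hg0 : ∀ p ∈ V, g p ≠ 0)
    (hFG : ∀ p ∈ V, Fcurv f p - Gcurv g p ≠ 0)
    (h : ∀ p ∈ V, dForm (fsmul (XiF f g) (om2 f g)) p = dForm (T2 f g) p ∧
      -dForm (fsmul (XiF f g) (om1 f g)) p = dForm (T1 f g) p) :
    ClosedAt U (fun _ => 0) (fun p => -(f p ^ 2 * g p)) (fun p => -(f p * g p ^ 2))
        (fun _ => 0) x := by
  obtain ⟨r, hr, hball⟩ := Metric.mem_nhds_iff.mp (hV.mem_nhds hx)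
  have hB : IsOpen (Metric.ball x r) := Metric.isOpen_ball
  have hΞ := differentiableOn_XiF hV hf hg hf0 hg0 hFG
  have lfz := (differentiableOn_pz hV hf).quot hf hf0
  have lfw := (differentiableOn_pw hV hf).quot hf hf0
  have lgz := (differentiableOn_pz hV hg).quot hg hg0
  have lgw := (differentiableOn_pw hV hg).quot hg hg0
  have hΞf := hΞ.fun_mul hf
  have hΞg := hΞ.fun_mul hg
  obtain ⟨P, hP, hP0, hPd⟩ := exists_pz_div_eq
    (((hΞf.fun_add (lgz.const_mul 2)).fun_add lfz).mono hball) (fun p hp => by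
      have hp' := hball hp
      have hn := hV.mem_nhds hp'
      have h1 := (h p hp').2
      rw [dForm_fsmul_om1, neg_neg, dForm_T1 hV hg hf0 hg0 hp'] at h1
      rw [pw_add ((hΞf.fun_add (lgz.const_mul 2)).differentiableAt hn) (lfz.differentiableAt hn),
        pw_add (hΞf.differentiableAt hn) ((lgz.const_mul 2).differentiableAt hn), h1,
        pw_mul (differentiableAt_const _) (lgz.differentiableAt hn), pw_const,
        pw_pz_div_self hV hf hf0 hp', Fcurv, Gcurv]
      ring)
  obtain ⟨Q, hQ, hQ0, hQd⟩ := exists_pw_div_eq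
    (((hΞg.fun_add (lfw.const_mul 2)).fun_add lgw).mono hball) (fun p hp => by
      have hp' := hball hp
      have hn := hV.mem_nhds hp'
      have h1 := (h p hp').1
      rw [dForm_fsmul_om2, dForm_T2 hV hf hf0 hg0 hp'] at h1
      rw [pz_add ((hΞg.fun_add (lfw.const_mul 2)).differentiableAt hn) (lgw.differentiableAt hn),
        pz_add (hΞg.differentiableAt hn) ((lfw.const_mul 2).differentiableAt hn), h1,
        pz_mul (differentiableAt_const _) (lfw.differentiableAt hn), pz_const,
        ← pw_pz_div_self hV hg hg0 hp', Fcurv, Gcurv]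
      ring)
  have hfB := hf.mono hball
  have hgB := hg.mono hball
  have hPQ : ∀ p ∈ Metric.ball x r, P p * Q p ≠ 0 := fun p _ => mul_ne_zero (hP0 p) (hQ0 p)
  refine ⟨Metric.ball x r, hB, Metric.mem_ball_self hr, hball.trans hVU,
    (P, fun _ => 0), (fun _ => 0, Q),
    (fun q => -(f q * f q * g q / (P q * Q q)), fun q => -(f q * g q * g q / (P q * Q q))),
    ⟨hP, differentiableOn_const _⟩, ⟨differentiableOn_const _, hQ⟩,
    ⟨(((hfB.fun_mul hfB).fun_mul hgB).quot (hP.fun_mul hQ) hPQ).fun_neg,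
      (((hfB.fun_mul hgB).fun_mul hgB).quot (hP.fun_mul hQ) hPQ).fun_neg⟩,
    fun p hp => ?_, fun p hp => ?_, fun p hp => ?_, fun p hp => ?_⟩
  · simp only [pz_const]
    exact (hPd p hp).1
  · simp only [pw_const]
    exact (hQd p hp).1.symm
  · simp only [pw_neg, pz_neg, neg_inj]
    rw [pw_eq_pz_quot_iff hfB hgB (fun p hp => hf0 p (hball hp)) (fun p hp => hg0 p (hball hp))
      hP hQ (fun p _ => hP0 p) (fun p _ => hQ0 p) hB hp (hPd p hp).1 (hQd p hp).1,
      (hPd p hp).2, (hQd p hp).2]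
    ring
  · have := hP0 p
    have := hQ0 p
    simp only [symC0, symC1, symC2, symC3]
    refine ⟨by ring, ?_, ?_, by ring⟩ <;> field_simp <;> ring

/-- `η = -f²g dz²dw - fg² dz dw²` is closed at `x` iff
`d(Ξ·ω2) = d(2h1ω2 + h2ω1)` and `-d(Ξ·ω1) = d(h1ω2 + 2h2ω1)` near `x`. -/
theorem stmt_15 (U : Set (ℂ × ℂ)) (hU : IsOpen U) (x : ℂ × ℂ) (hx : x ∈ U)
    (f g : ℂ × ℂ → ℂ)
    (hf : DifferentiableOn ℂ f U) (hg : DifferentiableOn ℂ g U)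
    (hf0 : ∀ p ∈ U, f p ≠ 0) (hg0 : ∀ p ∈ U, g p ≠ 0)
    (hFG : ∀ p ∈ U, Fcurv f p - Gcurv g p ≠ 0) :
    ClosedAt U (fun _ => 0) (fun p => -(f p ^ 2 * g p)) (fun p => -(f p * g p ^ 2))
        (fun _ => 0) x ↔
      ∃ V : Set (ℂ × ℂ), IsOpen V ∧ x ∈ V ∧ V ⊆ U ∧
        ∀ p ∈ V,
          dForm (fsmul (XiF f g) (om2 f g)) p = dForm (T2 f g) p ∧
          -dForm (fsmul (XiF f g) (om1 f g)) p = dForm (T1 f g) p := by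
  constructor
  · rintro ⟨V, hV, hxV, hVU, z1, z2, z3, hz1, hz2, hz3, hc1, hc2, hc3, heq⟩
    have hn := hV.mem_nhds hxV
    have hne : symC1 z1 z2 z3 x ≠ 0 := by
      rw [← (heq x hxV).2.1]
      exact neg_ne_zero.mpr (mul_ne_zero (pow_ne_zero _ (hf0 x hx)) (hg0 x hx))
    have hne' : symC2 z1 z2 z3 x ≠ 0 := by
      rw [← (heq x hxV).2.2.1]
      exact neg_ne_zero.mpr (mul_ne_zero (hf0 x hx) (pow_ne_zero _ (hg0 x hx)))
    have hA := eventually_eq_zero_of_mul_mul_eq_zero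
      (hz1.1.continuousOn.continuousAt hn) (hz2.1.continuousOn.continuousAt hn)
      (hz3.1.continuousOn.continuousAt hn)
      (Filter.eventually_of_mem hn fun p hp => (heq p hp).1.symm) hne
    have hB := eventually_eq_zero_of_mul_mul_eq_zero
      (hz1.2.continuousOn.continuousAt hn) (hz2.2.continuousOn.continuousAt hn)
      (hz3.2.continuousOn.continuousAt hn)
      (Filter.eventually_of_mem hn fun p hp => (heq p hp).2.2.2.symm)
      (r := z1.1 x) (s := z2.1 x) (t := z3.1 x)
      (fun h => hne' (by rw [symC2]; linear_combination h))
    have h1 : ∀ a b c : Form1, symC1 a b c = symC1 z1 z2 z3 →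
        ∀ p ∈ V, -(f p ^ 2 * g p) = symC1 a b c p := by
      intro a b c h p hp
      rw [h, ← (heq p hp).2.1]
    have h2 : ∀ a b c : Form1, symC2 a b c = symC2 z1 z2 z3 →
        ∀ p ∈ V, -(f p * g p ^ 2) = symC2 a b c p := by
      intro a b c h p hp
      rw [h, ← (heq p hp).2.2.1]
    rcases hA with hA | hA | hA <;> rcases hB with hB | hB | hB
    · exact absurd (by simp [symC1, hA.self_of_nhds, hB.self_of_nhds]) hne
    · exact exists_dForm_XiF_of_closed_factors hf hg hf0 hg0 hFG hV hVU hxV hz2 hz1 hc2 hc1 hc3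
        (h1 _ _ _ (by funext p; simp only [symC1]; ring))
        (h2 _ _ _ (by funext p; simp only [symC2]; ring)) hB hA
    · exact exists_dForm_XiF_of_closed_factors hf hg hf0 hg0 hFG hV hVU hxV hz3 hz1 hc3 hc1 hc2
        (h1 _ _ _ (by funext p; simp only [symC1]; ring))
        (h2 _ _ _ (by funext p; simp only [symC2]; ring)) hB hA
    · exact exists_dForm_XiF_of_closed_factors hf hg hf0 hg0 hFG hV hVU hxV hz1 hz2 hc1 hc2 hc3
        (h1 _ _ _ rfl) (h2 _ _ _ rfl) hB hA
    · exact absurd (by simp [symC1, hA.self_of_nhds, hB.self_of_nhds]) hne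
    · exact exists_dForm_XiF_of_closed_factors hf hg hf0 hg0 hFG hV hVU hxV hz3 hz2 hc3 hc2 hc1
        (h1 _ _ _ (by funext p; simp only [symC1]; ring))
        (h2 _ _ _ (by funext p; simp only [symC2]; ring)) hB hA
    · exact exists_dForm_XiF_of_closed_factors hf hg hf0 hg0 hFG hV hVU hxV hz1 hz3 hc1 hc3 hc2
        (h1 _ _ _ (by funext p; simp only [symC1]; ring))
        (h2 _ _ _ (by funext p; simp only [symC2]; ring)) hB hA
    · exact exists_dForm_XiF_of_closed_factors hf hg hf0 hg0 hFG hV hVU hxV hz2 hz3 hc2 hc3 hc1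
        (h1 _ _ _ (by funext p; simp only [symC1]; ring))
        (h2 _ _ _ (by funext p; simp only [symC2]; ring)) hB hA
    · exact absurd (by simp [symC1, hA.self_of_nhds, hB.self_of_nhds]) hne
  · rintro ⟨V, hV, hxV, hVU, h⟩
    exact closedAt_of_dForm_XiF hV hVU hxV (hf.mono hVU) (hg.mono hVU)
      (fun p hp => hf0 p (hVU hp)) (fun p hp => hg0 p (hVU hp)) (fun p hp => hFG p (hVU hp)) h
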